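/- Consider a path graph with n nodes and m = n−1 edges and a transaction matrix T. For 1 ≤ x ≤ y ≤ m define OPT(x,y) as the maximum, over all subsets A ⊆ {1,…,y} of the first y edges with max A = x (i.e., x ∈ A and every element of A is at most x), of Σ T[u,v] over transaction pairs u < v whose path edges {u,…,v−1} are contained in {1,…,y} and contain exactly one element of A. Define M[i,j,k] = Σ_{i ≤ u ≤ j < v ≤ k+1} T[u,v] for 1 ≤ i ≤ j ≤ k ≤ m. Then OPT satisfies the recurrence OPT(x,y) = max( M[1,x,y], max_{1 ≤ ℓ ≤ x−1} ( OPT(ℓ, x−1) + M[ℓ+1, x, y] ) ), where the inner maximum is omitted when x = 1. -/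

import Mathlib

/-- `M T i j k` is the total weight of transaction pairs `(u,v)`, `u < v`, whose
path edges lie in the edge interval `[i,k]` and cross edge `j`, i.e.
`i ≤ u ≤ j < v ≤ k+1`. -/
def M (T : ℕ → ℕ → ℕ) (i j k : ℕ) : ℕ :=
  ∑ p ∈ Finset.Icc i j ×ˢ Finset.Icc (j + 1) (k + 1), T p.1 p.2

/-- Total weight of transaction pairs `(u,v)`, `u < v`, whose path edges
`{u,…,v-1}` are contained in `{1,…,y}` and contain exactly one element of `A`. -/
def cutWeight (T : ℕ → ℕ → ℕ) (y : ℕ) (A : Finset ℕ) : ℕ :=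
  ∑ p ∈ (Finset.Icc 1 (y + 1) ×ˢ Finset.Icc 1 (y + 1)).filter
      (fun p => p.1 < p.2 ∧ (A ∩ Finset.Icc p.1 (p.2 - 1)).card = 1),
    T p.1 p.2

/-- `OPT T x y`: the maximum of `cutWeight T y A` over all subsets `A` of the
first `y` edges whose maximum element is `x`. -/
def OPT (T : ℕ → ℕ → ℕ) (x y : ℕ) : ℕ :=
  ((Finset.Icc 1 y).powerset.filter (fun A => x ∈ A ∧ ∀ a ∈ A, a ≤ x)).sup
    (cutWeight T y)

/-- A path crosses exactly one element of `insert x B`, where `l < x` is the maximum of `B`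
(or `l = 0` and `B` is empty), if and only if it stops before edge `x` and crosses exactly one
element of `B`, or it crosses edge `x` and starts after edge `l`. -/
theorem card_insert_inter_Icc_eq_one_iff {B : Finset ℕ} {l x u v : ℕ} (hlx : l < x)
    (hB : B ⊆ Finset.Icc 1 l) (hl : l = 0 ∨ l ∈ B) (hu : 1 ≤ u) (huv : u < v) :
    (insert x B ∩ Finset.Icc u (v - 1)).card = 1 ↔
      (v ≤ x ∧ (B ∩ Finset.Icc u (v - 1)).card = 1) ∨ (l < u ∧ u ≤ x ∧ x < v) := by
  have hxB : x ∉ B := fun h => by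
    have := Finset.mem_Icc.1 (hB h)
    omega
  by_cases hmem : x ∈ Finset.Icc u (v - 1)
  · have hmem' := Finset.mem_Icc.1 hmem
    rw [Finset.insert_inter_of_mem hmem, Finset.card_insert_of_notMem (by simp [hxB]),
      Nat.add_eq_right, Finset.card_eq_zero, Finset.eq_empty_iff_forall_notMem]
    refine ⟨fun h => Or.inr ⟨?_, by omega, by omega⟩, ?_⟩
    · by_contra hul
      have hlB : l ∈ B := hl.resolve_left (by omega)
      exact h l (Finset.mem_inter.2 ⟨hlB, Finset.mem_Icc.2 (by omega)⟩)
    · rintro (⟨h, -⟩ | ⟨h, -, -⟩) a ha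
      · omega
      · rw [Finset.mem_inter, Finset.mem_Icc] at ha
        have := Finset.mem_Icc.1 (hB ha.1)
        omega
  · rw [Finset.insert_inter_of_notMem hmem]
    rw [Finset.mem_Icc] at hmem
    refine ⟨fun h => Or.inl ⟨?_, h⟩, ?_⟩
    · obtain ⟨a, ha⟩ := Finset.card_pos.1 (h ▸ Nat.one_pos)
      rw [Finset.mem_inter, Finset.mem_Icc] at ha
      have := Finset.mem_Icc.1 (hB ha.1)
      omega
    · rintro (⟨-, h⟩ | h)
      · exact h
      · omega

theorem cutWeight_insert (T : ℕ → ℕ → ℕ) {B : Finset ℕ} {l x y : ℕ} (hlx : l < x) (hxy : x ≤ y)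
    (hB : B ⊆ Finset.Icc 1 l) (hl : l = 0 ∨ l ∈ B) :
    cutWeight T y (insert x B) = cutWeight T (x - 1) B + M T (l + 1) x y := by
  unfold cutWeight M
  rw [← Finset.sum_union]
  · congr 1
    ext ⟨u, v⟩
    simp only [Finset.mem_filter, Finset.mem_product, Finset.mem_union, Finset.mem_Icc]
    by_cases h : 1 ≤ u ∧ u < v
    · rw [card_insert_inter_Icc_eq_one_iff hlx hB hl h.1 h.2]
      generalize (B ∩ Finset.Icc u (v - 1)).card = c
      omega
    · omega
  · rw [Finset.disjoint_left]
    rintro ⟨u, v⟩ h h'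
    simp only [Finset.mem_filter, Finset.mem_product, Finset.mem_Icc] at h h'
    omega

theorem cutWeight_empty (T : ℕ → ℕ → ℕ) (y : ℕ) : cutWeight T y ∅ = 0 := by
  simp [cutWeight]

theorem cutWeight_singleton (T : ℕ → ℕ → ℕ) {x y : ℕ} (hx : 1 ≤ x) (hxy : x ≤ y) :
    cutWeight T y {x} = M T 1 x y := by
  have h := cutWeight_insert T (B := ∅) (l := 0) hx hxy (Finset.empty_subset _) (Or.inl rfl)
  simpa [cutWeight_empty] using h

theorem cutWeight_le_OPT (T : ℕ → ℕ → ℕ) {x y : ℕ} {A : Finset ℕ} (hA : A ⊆ Finset.Icc 1 y)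
    (hx : x ∈ A) (hmax : ∀ a ∈ A, a ≤ x) : cutWeight T y A ≤ OPT T x y :=
  Finset.le_sup (f := cutWeight T y)
    (Finset.mem_filter.2 ⟨Finset.mem_powerset.2 hA, hx, hmax⟩)

theorem exists_cutWeight_eq_OPT (T : ℕ → ℕ → ℕ) {x y : ℕ} (hx : 1 ≤ x) (hxy : x ≤ y) :
    ∃ A ⊆ Finset.Icc 1 y, x ∈ A ∧ (∀ a ∈ A, a ≤ x) ∧ OPT T x y = cutWeight T y A := by
  obtain ⟨A, hA, h⟩ := Finset.exists_mem_eq_sup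
    ((Finset.Icc 1 y).powerset.filter (fun A => x ∈ A ∧ ∀ a ∈ A, a ≤ x))
    ⟨{x}, by simp [hx, hxy]⟩ (cutWeight T y)
  rw [Finset.mem_filter, Finset.mem_powerset] at hA
  exact ⟨A, hA.1, hA.2.1, hA.2.2, h⟩

/-- The dynamic-programming recurrence for `OPT` on path graphs:
`OPT(x,y) = max (M[1,x,y]) (max_{1 ≤ ℓ ≤ x-1} (OPT(ℓ,x-1) + M[ℓ+1,x,y]))`,
where the inner maximum is omitted (empty, value `0`) when `x = 1`. -/
theorem OPT_recurrence (n : ℕ) (hn : 2 ≤ n)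
    (T : ℕ → ℕ → ℕ) (hsymm : ∀ i j, T i j = T j i) (hdiag : ∀ i, T i i = 0)
    (x y : ℕ) (hx : 1 ≤ x) (hxy : x ≤ y) (hy : y ≤ n - 1) :
    OPT T x y =
      max (M T 1 x y)
        ((Finset.Icc 1 (x - 1)).sup (fun l => OPT T l (x - 1) + M T (l + 1) x y)) := by
  apply le_antisymm
  · obtain ⟨A, hA, hxA, hmax, hopt⟩ := exists_cutWeight_eq_OPT T hx hxy
    rw [hopt, ← Finset.insert_erase hxA]
    have hlt : ∀ a ∈ A.erase x, 1 ≤ a ∧ a < x := fun a ha =>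
      ⟨(Finset.mem_Icc.1 (hA (Finset.mem_of_mem_erase ha))).1,
        lt_of_le_of_ne (hmax a (Finset.mem_of_mem_erase ha)) (Finset.ne_of_mem_erase ha)⟩
    rcases (A.erase x).eq_empty_or_nonempty with hB | hB
    · rw [hB, insert_empty_eq, cutWeight_singleton T hx hxy]
      exact le_max_left _ _
    · obtain ⟨l, hl, hlmax⟩ := (A.erase x).exists_max_image id hB
      have hlx := hlt l hl
      rw [cutWeight_insert T hlx.2 hxy
        (fun a ha => Finset.mem_Icc.2 ⟨(hlt a ha).1, hlmax a ha⟩) (Or.inr hl)]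
      refine le_trans (Nat.add_le_add_right (cutWeight_le_OPT T (fun a ha => ?_) hl hlmax) _)
        (le_trans (Finset.le_sup (f := fun l => OPT T l (x - 1) + M T (l + 1) x y)
          (Finset.mem_Icc.2 ⟨hlx.1, by omega⟩)) (le_max_right _ _))
      have := hlt a ha
      exact Finset.mem_Icc.2 (by omega)
  · refine max_le ?_ (Finset.sup_le fun l hl => ?_)
    · rw [← cutWeight_singleton T hx hxy]
      exact cutWeight_le_OPT T (by simp [hx, hxy]) (by simp) (by simp)
    · rw [Finset.mem_Icc] at hl
      obtain ⟨B, hB, hlB, hmax, hopt⟩ := exists_cutWeight_eq_OPT T hl.1 hl.2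
      rw [hopt, ← cutWeight_insert T (by omega) hxy
        (fun a ha => Finset.mem_Icc.2 ⟨(Finset.mem_Icc.1 (hB ha)).1, hmax a ha⟩) (Or.inr hlB)]
      have hbd : ∀ a ∈ insert x B, 1 ≤ a ∧ a ≤ x := by
        intro a ha
        rcases Finset.mem_insert.1 ha with rfl | ha
        · omega
        · have := Finset.mem_Icc.1 (hB ha)
          omega
      exact cutWeight_le_OPT T
        (fun a ha => Finset.mem_Icc.2 ⟨(hbd a ha).1, (hbd a ha).2.trans hxy⟩)
        (Finset.mem_insert_self _ _) (fun a ha => (hbd a ha).2)
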